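/- Let Γ be the rectangular contour with vertices ±3 ± iη/2 and let m₀ be the Stieltjes transform of the semicircle law. Then Im[ ∮_Γ m₀(z) m₀(z+iη) (m₀(z+iη) - m₀(z)) dz ] → 2π as η → 0⁺. -/

import Mathlib

open MeasureTheory intervalIntegral

/-- The semicircle density. -/
noncomputable def semicircle (x : ℝ) : ℝ :=
  if |x| ≤ 2 then Real.sqrt (4 - x ^ 2) / (2 * Real.pi) else 0

/-- The Stieltjes transform of the semicircle density. -/
noncomputable def m₀ (z : ℂ) : ℂ :=
  ∫ x : ℝ, (semicircle x : ℂ) / ((x : ℂ) - z)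

/-- Counterclockwise contour integral of `f` over the rectangle with vertices
`±3 ± i η/2`. -/
noncomputable def rectIntegral (η : ℝ) (f : ℂ → ℂ) : ℂ :=
  (∫ t in (-3 : ℝ)..3, f ((t : ℂ) - ((η / 2 : ℝ) : ℂ) * Complex.I))
    + Complex.I * (∫ t in (-(η / 2))..(η / 2), f ((3 : ℂ) + (t : ℂ) * Complex.I))
    - (∫ t in (-3 : ℝ)..3, f ((t : ℂ) + ((η / 2 : ℝ) : ℂ) * Complex.I))
    - Complex.I * (∫ t in (-(η / 2))..(η / 2), f ((-3 : ℂ) + (t : ℂ) * Complex.I))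

section

open Complex ComplexConjugate

/-- Roots of `w ^ 2 + z * w + 1` in the closed upper half disc are Hölder-1/2 functions of `z`. -/
lemma norm_sub_sq_le_of_quadratic {z z' w w' : ℂ} (h : w ^ 2 + z * w + 1 = 0)
    (h' : w' ^ 2 + z' * w' + 1 = 0) (hw : ‖w‖ ≤ 1) (hw' : ‖w'‖ ≤ 1)
    (him : 0 ≤ w.im) (him' : 0 ≤ w'.im) : ‖w' - w‖ ^ 2 ≤ ‖z' - z‖ := by
  have hsq : normSq w ≤ 1 := by rw [normSq_eq_norm_sq]; exact pow_le_one₀ (norm_nonneg _) hw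
  have hsq' : normSq w' ≤ 1 := by rw [normSq_eq_norm_sq]; exact pow_le_one₀ (norm_nonneg _) hw'
  have hle : normSq (w' - w) ≤ normSq (1 - w * w') := by
    simp only [normSq_apply, sub_re, sub_im, mul_re, mul_im, one_re, one_im] at *
    nlinarith [mul_nonneg (sub_nonneg.2 hsq) (sub_nonneg.2 hsq'), mul_nonneg him him']
  have hle2 : ‖w' - w‖ ≤ ‖1 - w * w'‖ := by
    rw [normSq_eq_norm_sq, normSq_eq_norm_sq] at hle
    exact (sq_le_sq₀ (norm_nonneg _) (norm_nonneg _)).1 hle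
  have key : (w' - w) * (1 - w * w') = (z' - z) * (w * w') := by
    linear_combination w' * h - w * h'
  calc ‖w' - w‖ ^ 2 = ‖w' - w‖ * ‖w' - w‖ := sq _
    _ ≤ ‖w' - w‖ * ‖1 - w * w'‖ := by gcongr
    _ = ‖z' - z‖ * (‖w‖ * ‖w'‖) := by rw [← norm_mul, key, norm_mul, norm_mul]
    _ ≤ ‖z' - z‖ * 1 := by
        gcongr
        exact mul_le_one₀ hw (norm_nonneg _) hw'
    _ = ‖z' - z‖ := mul_one _

lemma exists_root_norm_le_one (z : ℂ) : ∃ w : ℂ, w ^ 2 + z * w + 1 = 0 ∧ ‖w‖ ≤ 1 := by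
  obtain ⟨s, hs⟩ := IsAlgClosed.exists_pow_nat_eq (z ^ 2 - 4) (n := 2) (by norm_num)
  have hprod : ‖(-z + s) / 2‖ * ‖(-z - s) / 2‖ = 1 := by
    rw [← norm_mul, show (-z + s) / 2 * ((-z - s) / 2) = 1 by linear_combination (-1 / 4) * hs,
      norm_one]
  rcases le_total ‖(-z + s) / 2‖ 1 with hle | hle
  · exact ⟨_, by linear_combination (1 / 4) * hs, hle⟩
  · refine ⟨(-z - s) / 2, by linear_combination (1 / 4) * hs, ?_⟩
    nlinarith [norm_nonneg ((-z - s) / 2)]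

/-- Multiplying `w ^ 2 + z * w + 1 = 0` by `conj w` and taking imaginary parts. -/
lemma im_mul_normSq_of_quadratic {z w : ℂ} (h : w ^ 2 + z * w + 1 = 0) :
    z.im * normSq w = w.im * (1 - normSq w) := by
  have h1 : z * (w * conj w) = -(w * (w * conj w)) - conj w := by
    linear_combination conj w * h
  rw [mul_conj] at h1
  have := congrArg im h1
  simp only [mul_im, ofReal_re, ofReal_im, mul_zero, zero_add, sub_im, neg_im, conj_im] at this
  linarith

lemma exists_root_upper {z : ℂ} (hz : 0 < z.im) :
    ∃ w : ℂ, w ^ 2 + z * w + 1 = 0 ∧ ‖w‖ < 1 ∧ 0 < w.im := by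
  obtain ⟨w, hw, hn⟩ := exists_root_norm_le_one z
  have h0 : w ≠ 0 := by rintro rfl; simp at hw
  have hpos : 0 < normSq w := normSq_pos.2 h0
  have him := im_mul_normSq_of_quadratic hw
  have hle : normSq w ≤ 1 := by rw [normSq_eq_norm_sq]; exact pow_le_one₀ (norm_nonneg _) hn
  have hlt : normSq w < 1 := by
    refine lt_of_le_of_ne hle fun he => ?_
    rw [he] at him
    linarith
  refine ⟨w, hw, ?_, ?_⟩
  · rw [normSq_eq_norm_sq] at hlt
    exact (sq_lt_one_iff₀ (norm_nonneg _)).1 hlt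
  · exact pos_of_mul_pos_left (him ▸ mul_pos hz hpos) (by linarith)

lemma one_add_mul_ne_zero {w z : ℂ} (hw : ‖w‖ < 1) (hz : ‖z‖ ≤ 1) : 1 + w * z ≠ 0 := by
  intro h0
  have h1 : ‖w * z‖ = 1 := by rw [eq_neg_of_add_eq_zero_right h0]; simp
  rw [norm_mul] at h1
  nlinarith [norm_nonneg w, norm_nonneg z]

lemma integral_inv_one_add_mul_exp {w : ℂ} (hw : ‖w‖ < 1) :
    ∫ θ in (0 : ℝ)..2 * Real.pi, (1 + w * exp (θ * I))⁻¹ = 2 * Real.pi := by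
  have hd : DiffContOnCl ℂ (fun z : ℂ => (1 + w * z)⁻¹) (Metric.ball 0 |1|) := by
    refine DiffContOnCl.inv (Differentiable.diffContOnCl (by fun_prop)) fun z hz => ?_
    rw [abs_one, closure_ball _ one_ne_zero] at hz
    exact one_add_mul_ne_zero hw (by simpa using hz)
  have h := hd.circleAverage
  simp only [Real.circleAverage, circleMap, ofReal_one, one_mul, zero_add, mul_zero, add_zero,
    inv_one] at h
  rw [inv_smul_eq_iff₀ (by positivity)] at h
  simpa using h

lemma integral_poisson {w : ℂ} (hw : ‖w‖ < 1) :
    ∫ θ in (0 : ℝ)..Real.pi,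
      ((1 + w * exp (θ * I))⁻¹ + (1 + w * exp (-(θ * I)))⁻¹ - 1) = Real.pi := by
  set F : ℝ → ℂ := fun θ => (1 + w * exp (θ * I))⁻¹ with hF
  have hc : Continuous F :=
    Continuous.inv₀ (by fun_prop) fun θ =>
      one_add_mul_ne_zero hw (norm_exp_ofReal_mul_I θ).le
  have hper : Function.Periodic F (2 * Real.pi) := fun θ => by
    simp only [hF]
    rw [show ((θ + 2 * Real.pi : ℝ) : ℂ) * I = θ * I + 2 * Real.pi * I by push_cast; ring,
      exp_periodic]
  have hneg : ∀ θ : ℝ, (1 + w * exp (-(θ * I)))⁻¹ = F (-θ) := fun θ => by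
    simp [hF]
  have htot : (∫ θ in -Real.pi..Real.pi, F θ) = 2 * Real.pi := by
    have := hper.intervalIntegral_add_eq (-Real.pi) 0
    rw [show -Real.pi + 2 * Real.pi = Real.pi by ring, zero_add] at this
    rw [this]
    exact integral_inv_one_add_mul_exp hw
  simp_rw [hneg]
  change (∫ θ in (0 : ℝ)..Real.pi, (F θ + F (-θ) - 1)) = _
  rw [intervalIntegral.integral_sub, intervalIntegral.integral_add,
    intervalIntegral.integral_comp_neg (fun θ => F θ), neg_zero, add_comm,
    intervalIntegral.integral_add_adjacent_intervals, htot]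
  · simp; ring
  all_goals exact Continuous.intervalIntegrable (by fun_prop) _ _

lemma semicircle_eq (x : ℝ) : semicircle x = Real.sqrt (4 - x ^ 2) / (2 * Real.pi) := by
  unfold semicircle
  split_ifs with h
  · rfl
  · rw [Real.sqrt_eq_zero_of_nonpos, zero_div]
    nlinarith [sq_abs x, not_le.1 h]

lemma continuous_semicircle : Continuous semicircle := by
  rw [funext semicircle_eq]
  fun_prop

lemma semicircle_eq_zero {x : ℝ} {a b : ℝ} (ha : a ≤ -2) (hb : 2 ≤ b) (hx : x ∉ Set.Ioc a b) :
    semicircle x = 0 := by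
  rw [semicircle_eq, Real.sqrt_eq_zero_of_nonpos, zero_div]
  by_contra! h
  exact hx ⟨by nlinarith, by nlinarith⟩

lemma integral_semicircle_mul_eq_intervalIntegral (g : ℝ → ℂ) {a b : ℝ} (ha : a ≤ -2)
    (hb : 2 ≤ b) : ∫ x, semicircle x * g x = ∫ x in a..b, semicircle x * g x := by
  rw [integral_of_le (by linarith), setIntegral_eq_integral_of_forall_compl_eq_zero]
  intro x hx
  simp [semicircle_eq_zero ha hb hx]

lemma integral_semicircle_mul {g : ℝ → ℂ} (hg : Continuous g) :
    ∫ x, semicircle x * g x =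
      2 / Real.pi * ∫ θ in (0 : ℝ)..Real.pi, sin θ ^ 2 * g (2 * Real.cos θ) := by
  have hcont : Continuous fun x => (semicircle x : ℂ) * g x :=
    (continuous_ofReal.comp continuous_semicircle).mul hg
  have hsub := integral_deriv_smul_comp (a := 0) (b := Real.pi)
    (f := fun θ => 2 * Real.cos θ) (f' := fun θ => 2 * -Real.sin θ)
    (g := fun x => (semicircle x : ℂ) * g x)
    (fun θ _ => (Real.hasDerivAt_cos θ).const_mul 2) (by fun_prop) hcont
  simp only [Real.cos_zero, Real.cos_pi, mul_one, mul_neg] at hsub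
  rw [integral_semicircle_mul_eq_intervalIntegral g le_rfl le_rfl, integral_symm, ← hsub,
    ← intervalIntegral.integral_neg, ← intervalIntegral.integral_const_mul]
  refine integral_congr fun θ hθ => ?_
  rw [Set.uIcc_of_le Real.pi_pos.le] at hθ
  have hs : 0 ≤ Real.sin θ := Real.sin_nonneg_of_mem_Icc hθ
  have hsc : semicircle (2 * Real.cos θ) = Real.sin θ / Real.pi := by
    rw [semicircle_eq, show 4 - (2 * Real.cos θ) ^ 2 = (2 * Real.sin θ) ^ 2 by
      nlinarith [Real.sin_sq_add_cos_sq θ], Real.sqrt_sq (by positivity)]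
    field_simp
  simp only [Function.comp_apply, hsc, real_smul]
  push_cast
  ring

lemma integral_semicircle : ∫ x in (-3 : ℝ)..3, (semicircle x : ℂ) = 1 := by
  have h := integral_semicircle_mul (g := fun _ => 1) continuous_const
  rw [integral_semicircle_mul_eq_intervalIntegral _ (a := -3) (b := 3) (by norm_num)
    (by norm_num)] at h
  simp only [mul_one] at h
  rw [h]
  have hs : ∫ θ in (0 : ℝ)..Real.pi, sin θ ^ 2 = ((Real.pi / 2 : ℝ) : ℂ) := by
    have h2 : ∫ θ in (0 : ℝ)..Real.pi, Real.sin θ ^ 2 = Real.pi / 2 := by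
      rw [integral_sin_sq]; simp
    rw [← h2, ← intervalIntegral.integral_ofReal]
    push_cast
    rfl
  rw [hs]
  have := Real.pi_ne_zero
  push_cast
  field_simp

/-- The Stieltjes transform of the semicircle law is the root of `w ^ 2 + z * w + 1` in the open
unit disc. -/
lemma m₀_eq_of_quadratic {z w : ℂ} (hz : z.im ≠ 0) (h : w ^ 2 + z * w + 1 = 0) (hw : ‖w‖ < 1) :
    m₀ z = w := by
  have h0 : w ≠ 0 := by rintro rfl; simp at h
  have hzw : z = -(w + w⁻¹) := by
    field_simp
    linear_combination h
  have hne : ∀ x : ℝ, (x : ℂ) - z ≠ 0 := fun x hx => hz (by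
    rw [← sub_eq_zero.1 hx, ofReal_im])
  have hg : Continuous fun x : ℝ => ((x : ℂ) - z)⁻¹ :=
    Continuous.inv₀ (by fun_prop) hne
  have hpoint : ∀ θ : ℝ, sin θ ^ 2 * (((2 * Real.cos θ : ℝ) : ℂ) - z)⁻¹ =
      -(1 / 4) * (2 * (Real.cos θ : ℂ) + z) - (w⁻¹ - w) / 4 *
        ((1 + w * exp (θ * I))⁻¹ + (1 + w * exp (-(θ * I)))⁻¹ - 1) := by
    intro θ
    have hd := hne (2 * Real.cos θ)
    have h1 : 1 + w * exp (θ * I) ≠ 0 := one_add_mul_ne_zero hw (norm_exp_ofReal_mul_I θ).le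
    have h2 : 1 + w * exp (-(θ * I)) ≠ 0 := one_add_mul_ne_zero hw (by
      rw [← neg_mul, ← ofReal_neg, norm_exp_ofReal_mul_I])
    have hE : exp (θ * I) * exp (-(θ * I)) = 1 := by rw [← exp_add]; simp
    have hcos : 2 * cos (θ : ℂ) = exp (θ * I) + exp (-(θ * I)) := by
      rw [cos, neg_mul]; ring
    have hfac : ((2 * Real.cos θ : ℝ) : ℂ) - z =
        (1 + w * exp (θ * I)) * (1 + w * exp (-(θ * I))) / w := by
      rw [hzw]
      push_cast
      rw [hcos]
      field_simp
      linear_combination (-w ^ 2) * hE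
    rw [hfac, sin_sq, show cos (θ : ℂ) = (exp (θ * I) + exp (-(θ * I))) / 2 by
      rw [← hcos]; ring, ofReal_cos, show cos (θ : ℂ) = (exp (θ * I) + exp (-(θ * I))) / 2 by
      rw [← hcos]; ring, hzw]
    have he : exp (θ * I) ≠ 0 := exp_ne_zero _
    rw [eq_inv_of_mul_eq_one_right hE] at h2 ⊢
    generalize exp (θ * I) = e at *
    have h3 : e + w ≠ 0 := fun h => h2 (by field_simp; simpa using h)
    have h4 : 1 + e * w ≠ 0 := by rwa [mul_comm e w]
    field_simp
    ring
  have hF : Continuous fun θ : ℝ =>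
      (1 + w * exp (θ * I))⁻¹ + (1 + w * exp (-(θ * I)))⁻¹ - 1 := by
    refine ((Continuous.inv₀ (by fun_prop) fun θ => ?_).add
      (Continuous.inv₀ (by fun_prop) fun θ => ?_)).sub continuous_const
    · exact one_add_mul_ne_zero hw (norm_exp_ofReal_mul_I θ).le
    · exact one_add_mul_ne_zero hw (by rw [← neg_mul, ← ofReal_neg, norm_exp_ofReal_mul_I])
  have hlin : ∫ θ in (0 : ℝ)..Real.pi, (2 * (Real.cos θ : ℂ) + z) = Real.pi * z := by
    rw [intervalIntegral.integral_add, intervalIntegral.integral_const_mul,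
      intervalIntegral.integral_ofReal]
    · simp
    all_goals exact Continuous.intervalIntegrable (by fun_prop) _ _
  simp only [m₀, div_eq_mul_inv]
  rw [integral_semicircle_mul hg]
  simp_rw [hpoint]
  rw [intervalIntegral.integral_sub, intervalIntegral.integral_const_mul,
    intervalIntegral.integral_const_mul, integral_poisson hw, hlin, hzw]
  · have := ofReal_ne_zero.2 Real.pi_ne_zero
    field_simp
    ring
  · exact Continuous.intervalIntegrable (by fun_prop) _ _
  · exact Continuous.intervalIntegrable (hF.const_smul ((w⁻¹ - w) / 4)) _ _

lemma m₀_spec {z : ℂ} (hz : 0 < z.im) :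
    m₀ z ^ 2 + z * m₀ z + 1 = 0 ∧ ‖m₀ z‖ < 1 ∧ 0 < (m₀ z).im := by
  obtain ⟨w, hw, hn, him⟩ := exists_root_upper hz
  rw [m₀_eq_of_quadratic hz.ne' hw hn]
  exact ⟨hw, hn, him⟩

lemma m₀_conj (z : ℂ) : m₀ (conj z) = conj (m₀ z) := by
  simp only [m₀]
  rw [← integral_conj]
  simp

lemma norm_m₀_lt_one {z : ℂ} (hz : z.im ≠ 0) : ‖m₀ z‖ < 1 := by
  rcases hz.lt_or_gt with h | h
  · rw [← RCLike.norm_conj (m₀ z), ← m₀_conj]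
    exact (m₀_spec (by simpa using h)).2.1
  · exact (m₀_spec h).2.1

lemma measurable_m₀ : Measurable m₀ := by
  have : Measurable fun p : ℂ × ℝ => (semicircle p.2 : ℂ) / ((p.2 : ℂ) - p.1) := by
    have := continuous_semicircle.measurable
    fun_prop
  exact this.stronglyMeasurable.integral_prod_right.measurable

/-- The boundary value of `m₀` at `t` from the upper half plane. -/
lemma exists_boundary_value (t : ℝ) :
    ∃ M : ℂ, M ^ 2 + t * M + 1 = 0 ∧ ‖M‖ ≤ 1 ∧ 0 ≤ M.im ∧
      normSq M * M.im = Real.pi * semicircle t := by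
  have hpi := Real.pi_pos
  by_cases ht : t ^ 2 ≤ 4
  · have hs := Real.sq_sqrt (sub_nonneg.2 ht)
    have hs0 := Real.sqrt_nonneg (4 - t ^ 2)
    rw [semicircle_eq]
    generalize Real.sqrt (4 - t ^ 2) = s at hs hs0 ⊢
    have hnorm : normSq ⟨-t / 2, s / 2⟩ = 1 := by
      rw [normSq_mk]
      linarith
    refine ⟨⟨-t / 2, s / 2⟩, ?_, ?_, by positivity, ?_⟩
    · apply Complex.ext <;> simp [sq] <;> linarith
    · rw [normSq_eq_norm_sq] at hnorm
      exact (sq_le_one_iff₀ (norm_nonneg _)).1 hnorm.le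
    · rw [hnorm]
      field_simp
  · obtain ⟨M, hM, hn⟩ := exists_root_norm_le_one t
    have h := im_mul_normSq_of_quadratic hM
    have him : M.im = 0 := by
      rw [ofReal_im, zero_mul, eq_comm, mul_eq_zero] at h
      refine h.resolve_right fun h1 => ht ?_
      have h2 : M * conj M = 1 := by
        rw [mul_conj, ← sub_eq_zero.1 h1, ofReal_one]
      have h3 : M + conj M + t = 0 := by
        linear_combination conj M * hM - (M + t) * h2
      have h4 := congrArg re h3
      simp only [add_re, conj_re, ofReal_re, zero_re] at h4
      have h5 := normSq_apply M
      rw [show t = -2 * M.re by linarith]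
      nlinarith [sq_nonneg M.im]
    refine ⟨M, hM, hn, him.ge, ?_⟩
    rw [him, semicircle_eq, Real.sqrt_eq_zero_of_nonpos (by linarith)]
    simp

lemma tendsto_m₀_boundary {t : ℝ} {M : ℂ} (h : M ^ 2 + t * M + 1 = 0) (hn : ‖M‖ ≤ 1)
    (him : 0 ≤ M.im) :
    Filter.Tendsto (fun η : ℝ => m₀ (t + ((η / 2 : ℝ) : ℂ) * I)) (nhdsWithin 0 (Set.Ioi 0))
      (nhds M) := by
  rw [tendsto_iff_norm_sub_tendsto_zero]
  have hlim : Filter.Tendsto (fun η : ℝ => Real.sqrt (η / 2)) (nhdsWithin 0 (Set.Ioi 0))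
      (nhds 0) := by
    have : Continuous fun η : ℝ => Real.sqrt (η / 2) := by fun_prop
    simpa using (this.tendsto 0).mono_left nhdsWithin_le_nhds
  refine squeeze_zero' (Filter.Eventually.of_forall fun _ => norm_nonneg _) ?_ hlim
  filter_upwards [self_mem_nhdsWithin] with η (hη : 0 < η)
  obtain ⟨h1, h2, h3⟩ := m₀_spec (z := t + ((η / 2 : ℝ) : ℂ) * I) (by simpa using hη)
  apply Real.le_sqrt_of_sq_le
  refine (norm_sub_sq_le_of_quadratic h h1 hn h2.le him h3.le).trans_eq ?_
  rw [add_sub_cancel_left, norm_mul, norm_I, mul_one, norm_real, Real.norm_of_nonneg (by positivity)]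

lemma norm_integrand_le {η : ℝ} {z : ℂ} (hz : z.im ≠ 0) (hz' : z.im + η ≠ 0) :
    ‖m₀ z * m₀ (z + η * I) * (m₀ (z + η * I) - m₀ z)‖ ≤ 2 := by
  have h1 := norm_m₀_lt_one hz
  have h2 := norm_m₀_lt_one (z := z + η * I) (by simpa using hz')
  rw [norm_mul, norm_mul]
  calc _ ≤ 1 * 1 * (1 + 1 : ℝ) := by
        gcongr
        exact (norm_sub_le _ _).trans (by linarith)
    _ = 2 := by norm_num

lemma tendsto_integral_bottom :
    Filter.Tendsto (fun η : ℝ => ∫ t in (-3 : ℝ)..3,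
        m₀ (t - ((η / 2 : ℝ) : ℂ) * I) * m₀ (t - ((η / 2 : ℝ) : ℂ) * I + η * I) *
          (m₀ (t - ((η / 2 : ℝ) : ℂ) * I + η * I) - m₀ (t - ((η / 2 : ℝ) : ℂ) * I)))
      (nhdsWithin 0 (Set.Ioi 0)) (nhds (2 * Real.pi * I)) := by
  have hval : ∫ t in (-3 : ℝ)..3, 2 * Real.pi * I * (semicircle t : ℂ) = 2 * Real.pi * I := by
    rw [intervalIntegral.integral_const_mul, integral_semicircle, mul_one]
  rw [← hval]
  refine intervalIntegral.tendsto_integral_filter_of_dominated_convergence (fun _ => 2) ?_ ?_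
    (by simp) (Filter.Eventually.of_forall fun t _ => ?_)
  · refine Filter.Eventually.of_forall fun η => Measurable.aestronglyMeasurable ?_
    have := measurable_m₀
    fun_prop
  · filter_upwards [self_mem_nhdsWithin] with η (hη : 0 < η)
    refine Filter.Eventually.of_forall fun t _ => norm_integrand_le ?_ ?_
    · simpa using hη.ne'
    · simp only [sub_im, ofReal_im, im_ofReal_mul, I_im]
      linarith
  · obtain ⟨M, hM, hn, him, hval⟩ := exists_boundary_value t
    have hlim := tendsto_m₀_boundary hM hn him
    have hconj : Filter.Tendsto (fun η : ℝ => conj (m₀ (t + ((η / 2 : ℝ) : ℂ) * I)))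
        (nhdsWithin 0 (Set.Ioi 0)) (nhds (conj M)) :=
      (continuous_conj.tendsto M).comp hlim
    have heq : conj M * M * (M - conj M) = 2 * Real.pi * I * semicircle t := by
      rw [sub_conj, mul_comm (conj M), mul_conj]
      push_cast
      have := congrArg ((↑) : ℝ → ℂ) hval
      push_cast at this
      linear_combination 2 * I * this
    rw [← heq]
    refine ((hconj.mul hlim).mul (hlim.sub hconj)).congr fun η => ?_
    rw [← m₀_conj, show (t : ℂ) - ((η / 2 : ℝ) : ℂ) * I + η * I = t + ((η / 2 : ℝ) : ℂ) * I by
      push_cast; ring]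
    simp only [map_add, map_mul, conj_ofReal, conj_I, mul_neg, ← sub_eq_add_neg]

lemma tendsto_integral_top :
    Filter.Tendsto (fun η : ℝ => ∫ t in (-3 : ℝ)..3,
        m₀ (t + ((η / 2 : ℝ) : ℂ) * I) * m₀ (t + ((η / 2 : ℝ) : ℂ) * I + η * I) *
          (m₀ (t + ((η / 2 : ℝ) : ℂ) * I + η * I) - m₀ (t + ((η / 2 : ℝ) : ℂ) * I)))
      (nhdsWithin 0 (Set.Ioi 0)) (nhds 0) := by
  have hlim : Filter.Tendsto (fun η : ℝ => Real.sqrt η * |3 - (-3)|) (nhdsWithin 0 (Set.Ioi 0))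
      (nhds 0) := by
    have : Continuous fun η : ℝ => Real.sqrt η * |3 - (-3)| := by fun_prop
    simpa using (this.tendsto 0).mono_left nhdsWithin_le_nhds
  refine squeeze_zero_norm' ?_ hlim
  filter_upwards [self_mem_nhdsWithin] with η (hη : 0 < η)
  refine intervalIntegral.norm_integral_le_of_norm_le_const fun t _ => ?_
  set z : ℂ := t + ((η / 2 : ℝ) : ℂ) * I with hz
  have hzim : z.im = η / 2 := by simp [hz]
  obtain ⟨h1, h2, h3⟩ := m₀_spec (z := z) (by rw [hzim]; positivity)
  obtain ⟨h1', h2', h3'⟩ := m₀_spec (z := z + η * I) (by simp [hzim]; positivity)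
  rw [norm_mul, norm_mul]
  calc _ ≤ 1 * 1 * Real.sqrt η := by
        gcongr
        apply Real.le_sqrt_of_sq_le
        refine (norm_sub_sq_le_of_quadratic h1 h1' h2.le h2'.le h3.le h3'.le).trans_eq ?_
        rw [add_sub_cancel_left, norm_mul, norm_I, mul_one, norm_real,
          Real.norm_of_nonneg hη.le]
    _ = Real.sqrt η := by ring

lemma tendsto_integral_side (a : ℝ) :
    Filter.Tendsto (fun η : ℝ => ∫ t in (-(η / 2))..(η / 2),
        m₀ (a + t * I) * m₀ (a + t * I + η * I) * (m₀ (a + t * I + η * I) - m₀ (a + t * I)))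
      (nhdsWithin 0 (Set.Ioi 0)) (nhds 0) := by
  have hlim : Filter.Tendsto (fun η : ℝ => 2 * |η / 2 - -(η / 2)|) (nhdsWithin 0 (Set.Ioi 0))
      (nhds 0) := by
    have : Continuous fun η : ℝ => 2 * |η / 2 - -(η / 2)| := by fun_prop
    simpa using (this.tendsto 0).mono_left nhdsWithin_le_nhds
  refine squeeze_zero_norm' ?_ hlim
  filter_upwards [self_mem_nhdsWithin] with η (hη : 0 < η)
  refine intervalIntegral.norm_integral_le_of_norm_le_const_ae ?_
  filter_upwards [Measure.ae_ne volume (0 : ℝ)] with t ht hmem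
  rw [Set.uIoc_of_le (by linarith)] at hmem
  refine norm_integrand_le (by simpa using ht) ?_
  simp only [add_im, ofReal_im, im_ofReal_mul, I_im]
  linarith [hmem.1]

end

/-- As `η → 0⁺`,
`Im ∮_Γ m₀(z) m₀(z+iη) (m₀(z+iη) - m₀(z)) dz → 2π`, where `Γ` is the rectangular
contour with vertices `±3 ± iη/2`. -/
theorem contour_integral_limit :
    Filter.Tendsto (fun η : ℝ =>
        (rectIntegral η (fun z =>
          m₀ z * m₀ (z + (η : ℂ) * Complex.I) *
            (m₀ (z + (η : ℂ) * Complex.I) - m₀ z))).im)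
      (nhdsWithin 0 (Set.Ioi 0)) (nhds (2 * Real.pi)) := by
  have h := ((tendsto_integral_bottom.add
    ((tendsto_integral_side 3).const_mul Complex.I)).sub tendsto_integral_top).sub
    ((tendsto_integral_side (-3)).const_mul Complex.I)
  have him := (Complex.continuous_im.tendsto _).comp h
  convert him using 2
  · simp [rectIntegral]
  · simp
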